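/- Let p be a prime, K a finite extension of ℚ_p, and E a finite extension of K, with valuation rings 𝒪_K and 𝒪_E. Let e be the ramification index of E over K and assume the extension is tamely ramified, i.e. p does not divide e. Then for every uniformizer π of 𝒪_K there exist a finite extension E′ of E that is unramified over E (its ramification index over E equals 1) and an element x of the valuation ring 𝒪_{E′} with x^e = π; moreover any such x is a uniformizer of 𝒪_{E′}. (This is the true content established in the first step of the paper's uniformizer lemma for tame extensions: an e-th root of π exists after passing to an unramified extension of E.) -/

import Mathlib

open IsLocalRing

set_option synthInstance.maxHeartbeats 1000000
set_option maxHeartbeats 1000000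

/-- A witness for the conclusion of the tame-uniformizer lemma: a finite extension `E'` of
`E` which is unramified over `E` (ramification index `1`, expressed via
`m_E · 𝒪_{E'} = m_{E'}` where the valuation ring `𝒪_L` of a `p`-adic field `L` is the
integral closure of `ℤ_p` in `L`), together with an element `x` of the valuation ring of
`E'` satisfying `x ^ e = π`, such that moreover every element of the valuation ring of `E'`
whose `e`-th power is `π` is a uniformizer (a generator of the maximal ideal). -/
structure TameRootWitness (p : ℕ) [Fact p.Prime] (E : Type) [Field E]
    [Algebra ℤ_[p] E] [IsLocalRing (integralClosure ℤ_[p] E)]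
    (e : ℕ) (π : E) : Type 1 where
  /-- the extension field -/
  E' : Type
  [fieldE' : Field E']
  [algZpE' : Algebra ℤ_[p] E']
  [algEE' : Algebra E E']
  [towerE' : IsScalarTower ℤ_[p] E E']
  /-- `E'` is a finite extension of `E` -/
  finiteE' : FiniteDimensional E E'
  [localE' : IsLocalRing (integralClosure ℤ_[p] E')]
  /-- `E'` is unramified over `E`: the ramification index of `E'` over `E` equals `1`,
  i.e. `m_E · 𝒪_{E'} = m_{E'} ^ 1`. -/
  unramified :
    Ideal.map (IsScalarTower.toAlgHom ℤ_[p] E E').mapIntegralClosure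
        (maximalIdeal (integralClosure ℤ_[p] E))
      = maximalIdeal (integralClosure ℤ_[p] E') ^ 1
  /-- an element of the valuation ring `𝒪_{E'}` -/
  x : integralClosure ℤ_[p] E'
  /-- whose `e`-th power is `π` -/
  root : (x : E') ^ e = algebraMap E E' π
  /-- moreover, any element of `𝒪_{E'}` whose `e`-th power is `π` is a uniformizer of
  `𝒪_{E'}`, i.e. a generator of its maximal ideal -/
  uniformizer_of_root : ∀ y : integralClosure ℤ_[p] E',
    (y : E') ^ e = algebraMap E E' π →
    maximalIdeal (integralClosure ℤ_[p] E') = Ideal.span {y}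

/-- An element of an algebraic extension of `ℚ_[p]` is integral over `ℤ_[p]` if and only if its
spectral norm is at most `1`. -/
theorem PadicInt.isIntegral_iff_spectralNorm_le_one (p : ℕ) [Fact p.Prime] {L : Type*} [Field L]
    [Algebra ℚ_[p] L] [Algebra.IsAlgebraic ℚ_[p] L] [Algebra ℤ_[p] L]
    [IsScalarTower ℤ_[p] ℚ_[p] L] (x : L) :
    IsIntegral ℤ_[p] x ↔ spectralNorm ℚ_[p] L x ≤ 1 := by
  have hx : IsIntegral ℚ_[p] x := Algebra.IsIntegral.isIntegral x
  rw [spectralNorm, spectralValue_le_one_iff (minpoly.monic hx)]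
  constructor
  · intro h n
    rw [minpoly.isIntegrallyClosed_eq_field_fractions' ℚ_[p] h, Polynomial.coeff_map]
    exact PadicInt.norm_le_one _
  · intro h
    obtain ⟨q, hq, -, hmonic⟩ := Polynomial.lifts_and_natDegree_eq_and_monic
      (f := algebraMap ℤ_[p] ℚ_[p])
      ((Polynomial.lifts_iff_coeff_lifts _).2 fun n ↦ ⟨⟨_, h n⟩, rfl⟩) (minpoly.monic hx)
    refine ⟨q, hmonic, ?_⟩
    rw [IsScalarTower.algebraMap_eq ℤ_[p] ℚ_[p] L, ← Polynomial.eval₂_map, hq]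
    exact minpoly.aeval _ _

/-- The valuation ring of an algebraic extension of `ℚ_[p]` is local. -/
theorem PadicInt.isLocalRing_integralClosure (p : ℕ) [Fact p.Prime] (L : Type*) [Field L]
    [Algebra ℚ_[p] L] [Algebra.IsAlgebraic ℚ_[p] L] [Algebra ℤ_[p] L]
    [IsScalarTower ℤ_[p] ℚ_[p] L] : IsLocalRing (integralClosure ℤ_[p] L) := by
  have isUnit_of_one_le (x : integralClosure ℤ_[p] L)
      (hx : 1 ≤ spectralNorm ℚ_[p] L (x : L)) : IsUnit x := by
    have hx0 : (x : L) ≠ 0 := by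
      intro h
      rw [h, spectralNorm_zero] at hx
      exact absurd hx (by norm_num)
    have hinv : spectralNorm ℚ_[p] L (x : L)⁻¹ = (spectralNorm ℚ_[p] L (x : L))⁻¹ := by
      simp only [← spectralMulAlgNorm_def]
      exact map_inv₀ (spectralMulAlgNorm ℚ_[p] L) (x : L)
    have hmem : IsIntegral ℤ_[p] (x : L)⁻¹ := by
      rw [isIntegral_iff_spectralNorm_le_one, hinv]
      exact inv_le_one_of_one_le₀ hx
    exact IsUnit.of_mul_eq_one ⟨_, hmem⟩ (Subtype.ext (mul_inv_cancel₀ hx0))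
  refine ⟨fun {a b} hab ↦ ?_⟩
  have h := isNonarchimedean_spectralNorm (K := ℚ_[p]) (a : L) (b : L)
  rw [← AddMemClass.coe_add, hab, OneMemClass.coe_one, spectralNorm_one, le_max_iff] at h
  exact h.imp (isUnit_of_one_le a) (isUnit_of_one_le b)

/-- Adjoining an `e`-th root of a unit is formally unramified when `e` is invertible. -/
theorem Algebra.FormallyUnramified.of_pow_mem_range_of_adjoin_eq_top {A B : Type*} [CommRing A]
    [CommRing B] [Algebra A B] {e : ℕ} (he : IsUnit (e : B)) {α : B} (hα : IsUnit α)
    (hpow : α ^ e ∈ Set.range (algebraMap A B)) (htop : Algebra.adjoin A {α} = ⊤) :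
    Algebra.FormallyUnramified A B := by
  obtain ⟨u, hu⟩ := hpow
  have hD : KaehlerDifferential.D A B α = 0 := by
    have h := (KaehlerDifferential.D A B).leibniz_pow α e
    rw [← hu, Derivation.map_algebraMap, ← Nat.cast_smul_eq_nsmul B, smul_smul] at h
    exact ((he.mul (hα.pow _)).smul_eq_zero).1 h.symm
  have hD' : KaehlerDifferential.D A B = 0 :=
    Derivation.ext_of_adjoin_eq_top _ htop (by simpa using hD)
  refine ⟨?_⟩
  rw [← Submodule.subsingleton_iff B, ← subsingleton_iff_bot_eq_top,
    ← KaehlerDifferential.span_range_derivation, hD', eq_comm, Submodule.span_eq_bot]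
  rintro _ ⟨x, rfl⟩
  rfl

/-- If `L = E[α]` with `α ^ e` a unit of `A` and `e` invertible, then `α` generates the integral
closure of `A` in `L`. -/
theorem adjoin_eq_top_of_pow_eq_unit {A E L B : Type*} [CommRing A] [IsDomain A]
    [IsIntegrallyClosed A] [Field E] [Field L] [CommRing B] [IsDedekindDomain B]
    [Algebra A E] [IsFractionRing A E] [Algebra B L] [Algebra A B] [Algebra E L] [Algebra A L]
    [IsScalarTower A E L] [IsScalarTower A B L] [FiniteDimensional E L] [Algebra.IsSeparable E L]
    [IsIntegralClosure B A L] [Module.IsTorsionFree A B]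
    {e : ℕ} (he : IsUnit (e : B)) {α : B} (hα : IsUnit α)
    (hpow : α ^ e ∈ Set.range (algebraMap A B))
    (htop : Algebra.adjoin E {algebraMap B L α} = ⊤) :
    Algebra.adjoin A {α} = ⊤ := by
  obtain ⟨u, hu⟩ := hpow
  have hint : IsIntegral A α := IsIntegralClosure.isIntegral A L α
  obtain ⟨g, hg⟩ : minpoly A α ∣ (Polynomial.X ^ e - Polynomial.C u) :=
    minpoly.isIntegrallyClosed_dvd hint (by simp [hu])
  have hunit : IsUnit (Polynomial.aeval α (Polynomial.derivative (minpoly A α))) := by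
    have h := congrArg (fun f ↦ Polynomial.aeval α (Polynomial.derivative f)) hg
    simp only [Polynomial.derivative_mul, map_add, map_mul, minpoly.aeval, zero_mul, add_zero,
      Polynomial.derivative_sub, Polynomial.derivative_C, sub_zero,
      Polynomial.derivative_X_pow, map_natCast, map_pow, Polynomial.aeval_X] at h
    exact isUnit_of_mul_isUnit_left (h ▸ he.mul (hα.pow _))
  have h := conductor_mul_differentIdeal A E L α htop
  rw [Ideal.span_singleton_eq_top.2 hunit] at h
  exact adjoin_eq_top_of_conductor_eq_top (top_le_iff.1 (h ▸ Ideal.mul_le_left))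

/-- Every element of a field has an `e`-th root generating a finite extension. -/
theorem exists_finiteDimensional_pow_eq_adjoin_eq_top {E : Type} [Field E] {e : ℕ} (he : 0 < e)
    (u : E) : ∃ (L : Type) (_ : Field L) (_ : Algebra E L) (α : L),
      FiniteDimensional E L ∧ α ^ e = algebraMap E L u ∧ Algebra.adjoin E {α} = ⊤ := by
  let f : Polynomial E := Polynomial.X ^ e - Polynomial.C u
  have hdeg : f.natDegree ≠ 0 := by simpa [f] using he.ne'
  have : Fact (Irreducible f.factor) := ⟨Polynomial.irreducible_factor f⟩
  refine ⟨AdjoinRoot f.factor, inferInstance, inferInstance, AdjoinRoot.root f.factor,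
    (AdjoinRoot.powerBasis this.out.ne_zero).finite, ?_, AdjoinRoot.adjoinRoot_eq_top⟩
  obtain ⟨g, hg⟩ := Polynomial.factor_dvd_of_natDegree_ne_zero hdeg
  have h := congrArg (Polynomial.aeval (AdjoinRoot.root f.factor)) hg
  rw [map_mul, AdjoinRoot.aeval_eq, AdjoinRoot.aeval_eq, AdjoinRoot.mk_self, zero_mul,
    ← AdjoinRoot.aeval_eq] at h
  simpa [f, sub_eq_zero] using h

/-- Let `K` be a finite extension of `ℚ_p` and `E` a finite extension of `K`, with
valuation rings `𝒪_K = integralClosure ℤ_[p] K` and `𝒪_E = integralClosure ℤ_[p] E`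
(which are local rings).  Let `e` be the ramification index of `E` over `K`, i.e. the
positive integer with `m_K · 𝒪_E = m_E ^ e`, and assume `E/K` is tamely ramified, i.e.
`p ∤ e`.  Then for every uniformizer `π` of `𝒪_K` (generator of the maximal ideal) there
exist a finite extension `E'` of `E`, unramified over `E`, and an element `x ∈ 𝒪_{E'}`
with `x ^ e = π`; moreover any such `x` is a uniformizer of `𝒪_{E'}`. -/
theorem tamelyRamified_exists_unramified_root_uniformizer
    (p : ℕ) [Fact p.Prime]
    (K E : Type) [Field K] [Field E]
    [Algebra ℚ_[p] K] [FiniteDimensional ℚ_[p] K]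
    [Algebra ℚ_[p] E] [Algebra K E] [IsScalarTower ℚ_[p] K E]
    [FiniteDimensional K E]
    [Algebra ℤ_[p] K] [IsScalarTower ℤ_[p] ℚ_[p] K]
    [Algebra ℤ_[p] E] [IsScalarTower ℤ_[p] ℚ_[p] E] [IsScalarTower ℤ_[p] K E]
    [IsLocalRing (integralClosure ℤ_[p] K)]
    [IsLocalRing (integralClosure ℤ_[p] E)]
    (e : ℕ) (hepos : 0 < e)
    (he : Ideal.map (IsScalarTower.toAlgHom ℤ_[p] K E).mapIntegralClosure
            (maximalIdeal (integralClosure ℤ_[p] K))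
          = maximalIdeal (integralClosure ℤ_[p] E) ^ e)
    (htame : ¬ p ∣ e)
    (π : integralClosure ℤ_[p] K)
    (hπ : maximalIdeal (integralClosure ℤ_[p] K) = Ideal.span {π}) :
    Nonempty (TameRootWitness p E e (algebraMap K E (π : K))) := by
  have : FiniteDimensional ℚ_[p] E := .trans ℚ_[p] K E
  have : CharZero E := charZero_of_injective_algebraMap (algebraMap ℚ_[p] E).injective
  have : IsDedekindDomain (integralClosure ℤ_[p] E) :=
    integralClosure.isDedekindDomain ℤ_[p] ℚ_[p] E
  have : IsFractionRing (integralClosure ℤ_[p] E) E :=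
    integralClosure.isFractionRing_of_finite_extension ℚ_[p] E
  obtain ⟨ϖ, hϖ⟩ := (maximalIdeal_isPrincipal_of_isDedekindDomain (integralClosure ℤ_[p] E)).1
  rw [Ideal.submodule_span_eq] at hϖ
  obtain ⟨u, hu⟩ : Associated (ϖ ^ e)
      ((IsScalarTower.toAlgHom ℤ_[p] K E).mapIntegralClosure π) := by
    rw [← Ideal.span_singleton_eq_span_singleton, ← Ideal.span_singleton_pow, ← hϖ, ← he, hπ,
      Ideal.map_span, Set.image_singleton]
  replace hu : algebraMap K E (π : K) = (ϖ : E) ^ e * (u : integralClosure ℤ_[p] E) :=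
    (congrArg Subtype.val hu).symm
  obtain ⟨L, _, _, α, _, hα, htop⟩ := exists_finiteDimensional_pow_eq_adjoin_eq_top hepos
    ((u : integralClosure ℤ_[p] E) : E)
  let _ : Algebra ℤ_[p] L := ((algebraMap E L).comp (algebraMap ℤ_[p] E)).toAlgebra
  have : IsScalarTower ℤ_[p] E L := .of_algebraMap_eq' rfl
  let _ : Algebra ℚ_[p] L := ((algebraMap E L).comp (algebraMap ℚ_[p] E)).toAlgebra
  have : IsScalarTower ℚ_[p] E L := .of_algebraMap_eq' rfl
  have : IsScalarTower ℤ_[p] ℚ_[p] L := .to₁₂₄ ℤ_[p] ℚ_[p] E L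
  have : FiniteDimensional ℚ_[p] L := .trans ℚ_[p] E L
  have : IsDedekindDomain (integralClosure ℤ_[p] L) :=
    integralClosure.isDedekindDomain ℤ_[p] ℚ_[p] L
  have : IsLocalRing (integralClosure ℤ_[p] L) := PadicInt.isLocalRing_integralClosure p L
  let φ := (IsScalarTower.toAlgHom ℤ_[p] E L).mapIntegralClosure
  let _ : Algebra (integralClosure ℤ_[p] E) (integralClosure ℤ_[p] L) := φ.toRingHom.toAlgebra
  have : IsScalarTower (integralClosure ℤ_[p] E) (integralClosure ℤ_[p] L) L :=
    .of_algebraMap_eq fun _ ↦ rfl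
  have : IsIntegralClosure (integralClosure ℤ_[p] L) (integralClosure ℤ_[p] E) L :=
    .tower_top (R := ℤ_[p])
  have hinj : Function.Injective
      (algebraMap (integralClosure ℤ_[p] E) (integralClosure ℤ_[p] L)) := fun a b hab ↦
    Subtype.ext ((algebraMap E L).injective (congrArg Subtype.val hab))
  have : FaithfulSMul (integralClosure ℤ_[p] E) (integralClosure ℤ_[p] L) :=
    (faithfulSMul_iff_algebraMap_injective _ _).2 hinj
  have : Module.Finite (integralClosure ℤ_[p] E) (integralClosure ℤ_[p] L) :=
    IsIntegralClosure.finite _ E L _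
  have heunit : IsUnit (e : integralClosure ℤ_[p] L) := by
    have : IsUnit (e : ℤ_[p]) := by
      rwa [← not_not (a := IsUnit _), PadicInt.not_isUnit_iff, PadicInt.norm_natCast_lt_one_iff]
    simpa using this.map (algebraMap ℤ_[p] (integralClosure ℤ_[p] L))
  have hαint : IsIntegral ℤ_[p] α := .of_pow hepos <| by
    rw [hα]
    exact (u : integralClosure ℤ_[p] E).2.map (IsScalarTower.toAlgHom ℤ_[p] E L)
  let β : integralClosure ℤ_[p] L := ⟨α, hαint⟩
  have hβ : β ^ e = φ u := Subtype.ext hα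
  have hβunit : IsUnit β := (isUnit_pow_iff hepos.ne').1 (hβ ▸ u.isUnit.map φ)
  have hadjoin : Algebra.adjoin (integralClosure ℤ_[p] E) {β} = ⊤ :=
    adjoin_eq_top_of_pow_eq_unit (E := E) (L := L) heunit hβunit ⟨u, hβ.symm⟩ htop
  have : Algebra.FormallyUnramified (integralClosure ℤ_[p] E) (integralClosure ℤ_[p] L) :=
    .of_pow_mem_range_of_adjoin_eq_top heunit hβunit ⟨u, hβ.symm⟩ hadjoin
  have hmax : Ideal.map φ (maximalIdeal (integralClosure ℤ_[p] E)) =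
      maximalIdeal (integralClosure ℤ_[p] L) :=
    Algebra.FormallyUnramified.map_maximalIdeal
  refine ⟨{
    E' := L
    finiteE' := inferInstance
    unramified := by rw [pow_one]; exact hmax
    x := β * φ ϖ
    root := ?_
    uniformizer_of_root := fun y hy ↦ ?_ }⟩
  · rw [hu, map_mul, map_pow, ← hα, mul_comm, ← mul_pow]
    rfl
  · have hy' : φ ϖ ^ e * φ u = y ^ e := by
      refine Subtype.ext (Eq.trans ?_ hy.symm)
      rw [hu, map_mul, map_pow]
      rfl
    have hassoc : Associated (φ ϖ) y :=
      (Associated.pow_iff hepos.ne').1 ⟨u.map φ.toRingHom.toMonoidHom, hy'⟩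
    rw [← hmax, hϖ, Ideal.map_span, Set.image_singleton]
    exact Ideal.span_singleton_eq_span_singleton.2 hassoc
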